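/- arXiv:math/0405291 — 6 statements merged into one kernel-verified Lean document; each statement's English description precedes it below -/
import Mathlib

section
/- Under the standing assumptions, suppose R ∈ PD, limsup_{u→∞} P{ inf_{s∈[0,1]} X(s) < −u } / P{ sup_{s∈[0,1]} X(s) > u } < ∞, and that lim_{u→∞} R(u − v(u))/R(u) = 1 for every function v : ℝ → (0, ∞) with v(u)/u → 0 as u → ∞. Then for every t : (0, ∞) → (0, ∞) with t(u)/u^{1/γ} → 0 as u → ∞, the strong Piterbarg property holds: lim_{u→∞} P{ sup_{s∈[0, t(u)]} Y(s) > u } / P{ inf_{s∈[0, t(u)]} Y(s) > u } = 1. -/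
open MeasureTheory Filter Set

noncomputable section

theorem aux_dense {Ω : Type*} [MeasurableSpace Ω] (P : Measure Ω) (W : ℝ → Ω → ℝ)
    (hrc : ∀ᵐ ω ∂P, ∀ t : ℝ, 0 ≤ t → ContinuousWithinAt (fun s => W s ω) (Ici t) t)
    (g : ℝ → ℝ) (hg : ContinuousOn g (Ici 0)) (T : Set ℝ) (hT0 : ∀ s ∈ T, 0 ≤ s)
    (hT : ∀ s ∈ T, s ∈ range ((↑) : ℚ → ℝ) ∨ ∃ s', s < s' ∧ Ioo s s' ⊆ T) :
    P {ω | ∃ s ∈ T, g s < W s ω} = P {ω | ∃ s ∈ T ∩ range ((↑) : ℚ → ℝ), g s < W s ω} := by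
  apply measure_congr
  filter_upwards [hrc] with ω hω
  apply propext
  constructor
  · rintro ⟨s, hs, h⟩
    rcases hT s hs with hq | ⟨s', hs', hI⟩
    · exact ⟨s, ⟨hs, hq⟩, h⟩
    · have h0 := hT0 s hs
      have h1 : ContinuousWithinAt g (Ici s) s :=
        (hg s h0).mono (Ici_subset_Ici.2 h0)
      have h2 : ∀ᶠ x in nhdsWithin s (Ici s), g x < W x ω :=
        (h1.tendsto).eventually_lt (hω s h0).tendsto h
      have h3 : ∀ᶠ x in nhdsWithin s (Ioi s), g x < W x ω :=
        h2.filter_mono (nhdsWithin_mono _ Ioi_subset_Ici_self)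
      have h4 := h3.and (Ioo_mem_nhdsGT hs')
      obtain ⟨b, hb, hb2⟩ := (mem_nhdsGT_iff_exists_Ioo_subset).1 h4
      obtain ⟨q, hq1, hq2⟩ := exists_rat_btwn (show s < b from hb)
      have h5 := hb2 ⟨hq1, hq2⟩
      exact ⟨q, ⟨hI h5.2, q, rfl⟩, h5.1⟩
  · rintro ⟨s, hs, h⟩
    exact ⟨s, hs.1, h⟩

theorem aux_ss {Ω : Type*} [MeasurableSpace Ω] (P : Measure Ω)
    (X : ℝ → Ω → ℝ) (H : ℝ) (hX : ∀ s, Measurable (X s))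
    (hrc : ∀ᵐ ω ∂P, ∀ t : ℝ, 0 ≤ t → ContinuousWithinAt (fun s => X s ω) (Ici t) t)
    (hss : ∀ a : ℝ, 0 < a → ∀ n : ℕ, ∀ ts : Fin n → ℝ, (∀ i, 0 ≤ ts i) →
      Measure.map (fun ω (i : Fin n) => a ^ (-H) * X (a * ts i) ω) P =
        Measure.map (fun ω (i : Fin n) => X (ts i) ω) P)
    (a : ℝ) (ha : 0 < a) (σ : ℝ)
    (g : ℝ → ℝ) (hg : ContinuousOn g (Ici 0)) (T : Set ℝ) (hT0 : ∀ s ∈ T, 0 ≤ s)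
    (hT : ∀ s ∈ T, s ∈ range ((↑) : ℚ → ℝ) ∨ ∃ s', s < s' ∧ Ioo s s' ⊆ T) :
    P {ω | ∃ s ∈ T, g s < σ * (a ^ (-H) * X (a * s) ω)} = P {ω | ∃ s ∈ T, g s < σ * X s ω} := by
  rw [aux_dense P (fun s ω => σ * (a ^ (-H) * X (a * s) ω)) ?_ g hg T hT0 hT,
    aux_dense P (fun s ω => σ * X s ω) ?_ g hg T hT0 hT]
  · have hc : (T ∩ range ((↑) : ℚ → ℝ)).Countable := (countable_range _).mono inter_subset_right
    rcases (T ∩ range ((↑) : ℚ → ℝ)).eq_empty_or_nonempty with he | hne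
    · simp [he]
    · obtain ⟨q, hq⟩ := hc.exists_eq_range hne
      have hq0 : ∀ i, 0 ≤ q i := fun i => hT0 _ ((hq ▸ mem_range_self i : q i ∈ T ∩ _).1)
      rw [hq]
      have e1 : {ω | ∃ s ∈ range q, g s < σ * (a ^ (-H) * X (a * s) ω)} =
          ⋃ i, {ω | g (q i) < σ * (a ^ (-H) * X (a * q i) ω)} := by ext; simp
      have e2 : {ω | ∃ s ∈ range q, g s < σ * X s ω} =
          ⋃ i, {ω | g (q i) < σ * X (q i) ω} := by ext; simp
      rw [e1, e2, measure_iUnion_eq_iSup_accumulate, measure_iUnion_eq_iSup_accumulate]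
      congr 1
      ext n
      have hm := hss a ha (n+1) (fun i => q i) (fun i => hq0 i)
      have hS : MeasurableSet {x : Fin (n+1) → ℝ | ∃ i : Fin (n+1), g (q i) < σ * x i} := by
        rw [ofPred_exists]
        refine MeasurableSet.iUnion fun i => measurableSet_lt measurable_const ?_
        fun_prop
      have h3 := congrArg (fun μ => μ {x : Fin (n+1) → ℝ | ∃ i : Fin (n+1), g (q i) < σ * x i}) hm
      rw [Measure.map_apply _ hS, Measure.map_apply _ hS] at h3
      · convert h3 using 2
        · ext ω
          simp only [Set.mem_accumulate, mem_ofPred_eq, mem_preimage, Fin.exists_iff, Nat.lt_succ_iff, exists_prop]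
        · ext ω
          simp only [Set.mem_accumulate, mem_ofPred_eq, mem_preimage, Fin.exists_iff, Nat.lt_succ_iff, exists_prop]
      · exact measurable_pi_lambda _ fun i => hX _
      · exact measurable_pi_lambda _ fun i => (hX _).const_mul _
  · filter_upwards [hrc] with ω hω t ht
    exact (hω t ht).const_smul σ
  · filter_upwards [hrc] with ω hω t ht
    have h1 : ContinuousWithinAt (fun s => X (a * s) ω) (Ici t) t := by
      have := hω (a * t) (by positivity)
      refine ContinuousWithinAt.comp (f := fun s => a * s) (t := Ici (a * t)) this (by fun_prop) ?_
      intro x hx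
      exact mul_le_mul_of_nonneg_left hx ha.le
    exact (h1.const_smul (a ^ (-H))).const_smul σ

theorem aux_E (R : ℝ → ℝ) (hRpos : ∀ u, 0 < R u)
    (hRv : ∀ v : ℝ → ℝ, (∀ u, 0 < v u) → Tendsto (fun u : ℝ => v u / u) atTop (nhds 0) →
      Tendsto (fun u : ℝ => R (u - v u) / R u) atTop (nhds 1)) (ε : ℝ) (hε : 0 < ε) :
    ∃ n : ℕ, ∃ x0, ∀ x, x0 ≤ x → R (x - x / (n + 2)) ≤ (1 + ε) * R x := by
  by_contra! hcon
  choose f hf1 hf2 using hcon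
  let x : ℕ → ℝ := fun n => Nat.rec (f 0 1) (fun k y => f (k+1) (y + 1)) n
  have hx1 : ∀ n, x n + 1 ≤ x (n+1) := fun n => hf1 (n+1) (x n + 1)
  have hbad : ∀ n : ℕ, (1 + ε) * R (x n) < R (x n - x n / (n + 2)) := by
    intro n
    cases n with
    | zero => exact hf2 0 1
    | succ k => exact hf2 (k+1) (x k + 1)
  have hsm : StrictMono x := strictMono_nat_of_lt_succ fun n => by linarith [hx1 n]
  have hge : ∀ n : ℕ, (n : ℝ) + 1 ≤ x n := by
    intro n
    induction n with
    | zero => have : 1 ≤ x 0 := hf1 0 1; simpa using this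
    | succ k ih => have := hx1 k; push_cast; linarith
  have hxt : Tendsto x atTop atTop :=
    tendsto_atTop_mono (fun n => by linarith [hge n]) (tendsto_natCast_atTop_atTop (R := ℝ))
  let v : ℝ → ℝ := Function.extend x (fun n => x n / (n + 2)) (fun _ => 1)
  have hvx : ∀ n, v (x n) = x n / (n + 2) := fun n => hsm.injective.extend_apply _ _ n
  have hvo : ∀ y, (¬ ∃ n, x n = y) → v y = 1 := fun y hy => Function.extend_apply' _ _ _ hy
  have hxpos : ∀ n, 0 < x n := fun n => lt_of_lt_of_le (by positivity) (hge n)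
  have hvpos : ∀ y, 0 < v y := by
    intro y
    rcases Classical.em (∃ n, x n = y) with hy | hy
    · obtain ⟨n, rfl⟩ := hy
      rw [hvx]; have := hxpos n; positivity
    · rw [hvo y hy]; norm_num
  have hvt : Tendsto (fun u : ℝ => v u / u) atTop (nhds 0) := by
    rw [Metric.tendsto_atTop]
    intro e he
    obtain ⟨N, hN⟩ := exists_nat_gt (1 / e)
    refine ⟨x N, fun y hy => ?_⟩
    have hy0 : 0 < y := (hxpos N).trans_le hy
    have hNy : 1 / e < y := by linarith [hge N]
    rw [Real.dist_eq, sub_zero, abs_of_pos (div_pos (hvpos y) hy0)]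
    rcases Classical.em (∃ n, x n = y) with hyn | hyn
    · obtain ⟨n, rfl⟩ := hyn
      have hn : N ≤ n := hsm.le_iff_le.1 hy
      rw [hvx, div_div, mul_comm, ← div_div, div_self (hxpos n).ne']
      have hn' : (N : ℝ) ≤ n := by exact_mod_cast hn
      rw [div_lt_comm₀ (by positivity) he]
      linarith
    · rw [hvo y hyn, div_lt_comm₀ hy0 he]
      exact hNy
  have h := ((hRv v hvpos hvt).comp hxt).eventually (gt_mem_nhds (show (1:ℝ) < 1 + ε by linarith))
  obtain ⟨n, hn⟩ := h.exists
  simp only [Function.comp, hvx] at hn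
  rw [div_lt_iff₀ (hRpos _)] at hn
  linarith [hbad n]

theorem aux_D (R : ℝ → ℝ) (hRpos : ∀ u, 0 < R u) (hRanti : Antitone R)
    (hPD : ∃ l : ℝ, 1 < l ∧ limsup (fun u => R (l * u) / R u) atTop < 1) (ε : ℝ) (hε : 0 < ε) :
    ∃ K, 0 < K ∧ ∃ x0, ∀ x, x0 ≤ x → R (K * x) ≤ ε * R x := by
  obtain ⟨l, hl, hlim⟩ := hPD
  obtain ⟨q', hq1, hq2⟩ := exists_between hlim
  have hev : ∀ᶠ u in atTop, R (l * u) / R u < q' := by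
    refine eventually_lt_of_limsup_lt hq1 ?_
    refine isBoundedUnder_of_eventually_le (a := 1) ?_
    · filter_upwards [eventually_ge_atTop 0] with u hu
      rw [div_le_one (hRpos _)]
      exact hRanti (by nlinarith)
  obtain ⟨x0, hx0⟩ := eventually_atTop.1 hev
  have hq0 : 0 < q' := lt_trans (div_pos (hRpos _) (hRpos _)) (hx0 x0 le_rfl)
  obtain ⟨n, hn⟩ := exists_pow_lt_of_lt_one hε hq2
  have key : ∀ n : ℕ, ∀ x, max x0 0 ≤ x → R (l ^ n * x) ≤ q' ^ n * R x := by
    intro n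
    induction n with
    | zero => intro x _; simp
    | succ k ih =>
      intro x hx
      have hx' : max x0 0 ≤ l ^ k * x := by
        have h1 : 1 ≤ l ^ k := one_le_pow₀ hl.le
        have h2 : 0 ≤ x := (le_max_right _ _).trans hx
        nlinarith
      have h3 := hx0 _ ((le_max_left _ _).trans hx')
      rw [div_lt_iff₀ (hRpos _)] at h3
      have h4 := ih x hx
      rw [pow_succ', pow_succ', mul_assoc, mul_assoc]
      nlinarith
  refine ⟨l ^ n, by positivity, max x0 0, fun x hx => (key n x hx).trans ?_⟩
  exact mul_le_mul_of_nonneg_right hn.le (hRpos x).le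

theorem aux_F (γ : ℝ) (hγ : 0 < γ) (η : ℝ) (hη : 0 < η) (hη1 : η < 1) :
    ∃ C, 0 < C ∧ ∀ s t r : ℝ, 0 ≤ s → s ≤ t → s ≤ r →
      (1 - η) * r ^ γ ≤ (r - s) ^ γ + C * t ^ γ := by
  set β := (1 - η) ^ (1 / γ) with hβ
  have hβ0 : 0 < β := Real.rpow_pos_of_pos (by linarith) _
  have hβ1 : β < 1 := Real.rpow_lt_one (by linarith) (by linarith) (by positivity)
  have hβγ : β ^ γ = 1 - η := by
    rw [hβ, ← Real.rpow_mul (by linarith), one_div_mul_cancel hγ.ne', Real.rpow_one]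
  have h1β : 0 < 1 - β := by linarith
  refine ⟨(1 / (1 - β)) ^ γ, by positivity, fun s t r hs hst hsr => ?_⟩
  have hr : 0 ≤ r := hs.trans hsr
  have ht : 0 ≤ t := hs.trans hst
  rw [← Real.mul_rpow (by positivity) ht]
  by_cases h : t ≤ (1 - β) * r
  · have h2 : β * r ≤ r - s := by linarith
    have h3 := Real.rpow_le_rpow (by positivity) h2 hγ.le
    rw [Real.mul_rpow hβ0.le hr, hβγ] at h3
    have : 0 ≤ (1 / (1 - β) * t) ^ γ := by positivity
    linarith
  · push Not at h
    have h2 : r ≤ 1 / (1 - β) * t := by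
      rw [one_div, ← div_eq_inv_mul, le_div_iff₀ h1β]; linarith
    have h3 := Real.rpow_le_rpow hr h2 hγ.le
    have h4 : 0 ≤ (r - s) ^ γ := Real.rpow_nonneg (by linarith) _
    have h5 : 0 ≤ r ^ γ := by positivity
    nlinarith


theorem storage_statement_11
    {Ω : Type*} [MeasurableSpace Ω] (P : Measure Ω) [IsProbabilityMeasure P]
    (X : ℝ → Ω → ℝ) (H c γ : ℝ)
    (hH : 0 < H) (hc : 0 < c) (hγ : H < γ)
    (hmeas : Measurable (Function.uncurry X))
    (hX0 : ∀ᵐ ω ∂P, X 0 ω = 0)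
    (hpath : ∀ᵐ ω ∂P,
      (∀ t : ℝ, 0 ≤ t → ContinuousWithinAt (fun s => X s ω) (Ici t) t) ∧
      (∀ T : ℝ, 0 < T → ∃ M : ℝ, ∀ s ∈ Icc (0 : ℝ) T, |X s ω| ≤ M))
    (hss : ∀ a : ℝ, 0 < a → ∀ n : ℕ, ∀ ts : Fin n → ℝ, (∀ i, 0 ≤ ts i) →
      Measure.map (fun ω (i : Fin n) => a ^ (-H) * X (a * ts i) ω) P =
        Measure.map (fun ω (i : Fin n) => X (ts i) ω) P)
    (Y : ℝ → Ω → EReal)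
    (hY : ∀ t ω, Y t ω = ⨆ s : {s : ℝ // t ≤ s},
      (((X (s : ℝ) ω - X t ω - c * ((s : ℝ) - t) ^ γ : ℝ) : EReal)))
    (R : ℝ → ℝ) (hRpos : ∀ u, 0 < R u) (hRanti : Antitone R)
    (hR0 : Tendsto R atTop (nhds 0))
    (hRtail : Tendsto (fun u : ℝ =>
      (P {ω | (u : EReal) < ⨆ s : {s : ℝ // 0 < s},
        (((X (s : ℝ) ω / (1 + c * (s : ℝ) ^ γ) : ℝ) : EReal))}).toReal / R u)
      atTop (nhds 1))
    (hPD : ∃ l : ℝ, 1 < l ∧ limsup (fun u => R (l * u) / R u) atTop < 1)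
    (hcomp : limsup (fun u : ℝ =>
      (((P {ω | (⨅ s : Icc (0 : ℝ) 1, ((X (s : ℝ) ω : ℝ) : EReal)) < ((-u : ℝ) : EReal)}).toReal /
        (P {ω | ((u : ℝ) : EReal) < (⨆ s : Icc (0 : ℝ) 1, ((X (s : ℝ) ω : ℝ) : EReal))}).toReal : ℝ) : EReal)) atTop < ⊤)
    (hRv : ∀ v : ℝ → ℝ, (∀ u, 0 < v u) → Tendsto (fun u : ℝ => v u / u) atTop (nhds 0) →
      Tendsto (fun u : ℝ => R (u - v u) / R u) atTop (nhds 1))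
        : ∀ t : ℝ → ℝ, (∀ u : ℝ, 0 < u → 0 < t u) →
      Tendsto (fun u : ℝ => t u / u ^ (1 / γ)) atTop (nhds 0) →
      Tendsto (fun u : ℝ => (P {ω | (u : EReal) < ⨆ s : Icc (0 : ℝ) (t u), Y (s : ℝ) ω}).toReal / (P {ω | (u : EReal) < ⨅ s : Icc (0 : ℝ) (t u), Y (s : ℝ) ω}).toReal) atTop (nhds 1) := by
  intro t ht htu
  have hXm : ∀ s, Measurable (X s) := fun s => hmeas.comp measurable_prodMk_left
  have hrc : ∀ᵐ ω ∂P, ∀ t : ℝ, 0 ≤ t → ContinuousWithinAt (fun s => X s ω) (Ici t) t := by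
    filter_upwards [hpath] with ω hω using hω.1
  have hγ0 : 0 < γ := hH.trans hγ
  set κ := 1 - H / γ with hκ
  have hκ0 : 0 < κ := by rw [hκ, sub_pos, div_lt_one hγ0]; exact hγ
  have hκt : Tendsto (fun u : ℝ => u ^ κ) atTop atTop := tendsto_rpow_atTop hκ0
  have hau : ∀ u : ℝ, 0 < u → (u ^ (1 / γ)) ^ (-H) * u = u ^ κ := by
    intro u hu
    rw [← Real.rpow_mul hu.le]
    nth_rewrite 2 [← Real.rpow_one u]
    rw [← Real.rpow_add hu]
    congr 1
    rw [hκ]; field_simp; ring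
  have hgc : ContinuousOn (fun s : ℝ => 1 + c * s ^ γ) (Ici 0) := by
    refine Continuous.continuousOn ?_
    have := Real.continuous_rpow_const hγ0.le
    fun_prop
  obtain ⟨G, hGdef⟩ : ∃ G : ℝ → ℝ, ∀ w, G w = P.real {ω | ∃ s ∈ Ioi (0:ℝ), w * (1 + c * s ^ γ) < X s ω} :=
    ⟨_, fun _ => rfl⟩
  obtain ⟨M, hMdef⟩ : ∃ M : ℝ → ℝ → ℝ → ℝ, ∀ σ t w, M σ t w = P.real {ω | ∃ s ∈ Icc (0:ℝ) t, w < σ * X s ω} :=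
    ⟨_, fun _ _ _ => rfl⟩
  have hpos1 : ∀ s : ℝ, 0 ≤ s → 0 < 1 + c * s ^ γ := fun s hs => by
    have := Real.rpow_nonneg hs γ
    positivity
  have hG : Tendsto (fun w => G w / R w) atTop (nhds 1) := by
    convert hRtail using 5 with w
    rw [hGdef, measureReal_def]
    congr 2
    ext ω
    simp only [mem_ofPred_eq, lt_iSup_iff, EReal.coe_lt_coe_iff, Subtype.exists, mem_Ioi, exists_prop]
    refine exists_congr fun s => and_congr_right fun hs => ?_
    rw [lt_div_iff₀ (hpos1 s hs.le)]
  have hGup : ∀ ε : ℝ, 0 < ε → ∃ x0, ∀ x, x0 ≤ x → G x ≤ (1 + ε) * R x := by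
    intro ε hε
    obtain ⟨x0, h⟩ := eventually_atTop.1 (hG.eventually (gt_mem_nhds (show (1:ℝ) < 1 + ε by linarith)))
    refine ⟨x0, fun x hx => ?_⟩
    have := h x hx
    rw [div_lt_iff₀ (hRpos x)] at this
    exact this.le
  have hGlo : ∀ ε : ℝ, 0 < ε → ∃ x0, ∀ x, x0 ≤ x → (1 - ε) * R x ≤ G x := by
    intro ε hε
    obtain ⟨x0, h⟩ := eventually_atTop.1 (hG.eventually (lt_mem_nhds (show 1 - ε < (1:ℝ) by linarith)))
    refine ⟨x0, fun x hx => ?_⟩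
    have := h x hx
    rw [lt_div_iff₀ (hRpos x)] at this
    exact this.le
  have hB : ∀ u θ : ℝ, 0 < u → P.real {ω | ∃ r ∈ Ioi (0:ℝ), θ * (u + c * r ^ γ) < X r ω} = G (θ * u ^ κ) := by
    intro u θ hu
    have ha : 0 < u ^ (1 / γ) := Real.rpow_pos_of_pos hu _
    have haγ : (u ^ (1 / γ)) ^ γ = u := by
      rw [← Real.rpow_mul hu.le, one_div_mul_cancel hγ0.ne', Real.rpow_one]
    have hau' := hau u hu
    have h := aux_ss P X H hXm hrc hss (u ^ (1 / γ)) ha 1 (fun s => (θ * u ^ κ) * (1 + c * s ^ γ))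
      (hgc.const_smul (θ * u ^ κ)) (Ioi 0) (fun s hs => le_of_lt hs)
      (fun s hs => Or.inr ⟨s + 1, by linarith, fun x hx => lt_trans hs hx.1⟩)
    simp only [one_mul] at h
    rw [hGdef, measureReal_def, measureReal_def, ← h]
    congr 2
    ext ω
    generalize u ^ (1 / γ) = a at *
    have key : ∀ s : ℝ, 0 < s → (θ * u ^ κ * (1 + c * s ^ γ) < a ^ (-H) * X (a * s) ω ↔
        θ * (u + c * (a * s) ^ γ) < X (a * s) ω) := by
      intro s hs
      have h1 : θ * u ^ κ * (1 + c * s ^ γ) = a ^ (-H) * (θ * (u + c * (a * s) ^ γ)) := by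
        rw [Real.mul_rpow ha.le hs.le, haγ, ← hau']; ring
      rw [h1, mul_lt_mul_iff_right₀ (Real.rpow_pos_of_pos ha _)]
    constructor
    · rintro ⟨r, hr, h2⟩
      have hr0 : 0 < r := hr
      refine ⟨r / a, div_pos hr ha, ?_⟩
      rw [key _ (div_pos hr ha), mul_div_cancel₀ _ ha.ne']
      exact h2
    · rintro ⟨s, hs, h2⟩
      exact ⟨a * s, mul_pos ha hs, (key s hs).1 h2⟩
  have hC : ∀ σ t w : ℝ, 0 < t → M σ t w = M σ 1 (t ^ (-H) * w) := by
    intro σ t w ht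
    have h := aux_ss P X H hXm hrc hss t ht σ (fun s => t ^ (-H) * w) continuousOn_const (Icc 0 1)
      (fun s hs => hs.1) ?_
    · rw [hMdef, hMdef, measureReal_def, measureReal_def, ← h]
      congr 2
      ext ω
      have hp : 0 < t ^ (-H) := Real.rpow_pos_of_pos ht _
      constructor
      · rintro ⟨r, hr, h2⟩
        refine ⟨r / t, ⟨div_nonneg hr.1 ht.le, (div_le_one ht).2 hr.2⟩, ?_⟩
        rw [mul_div_cancel₀ _ ht.ne', mul_left_comm]
        exact mul_lt_mul_of_pos_left h2 hp
      · rintro ⟨s, hs, h2⟩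
        refine ⟨t * s, ⟨mul_nonneg ht.le hs.1, by nlinarith [hs.2]⟩, ?_⟩
        rw [mul_left_comm] at h2
        exact lt_of_mul_lt_mul_left h2 hp.le
    · intro s hs
      rcases hs.2.lt_or_eq with h1 | h1
      · exact Or.inr ⟨1, h1, fun x hx => ⟨hs.1.trans hx.1.le, hx.2.le⟩⟩
      · exact Or.inl ⟨1, by simp [h1]⟩
  have hSG : ∀ w : ℝ, 0 < w → M 1 1 w ≤ G (w / (1 + c)) := by
    intro w hw
    rw [hMdef, hGdef, measureReal_def, measureReal_def]
    refine ENNReal.toReal_mono (measure_ne_top _ _) (measure_mono_ae ?_)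
    filter_upwards [hX0] with ω hω
    rintro ⟨s, hs, h⟩
    rw [one_mul] at h
    have hs0 : 0 < s := by
      rcases hs.1.lt_or_eq with h1 | h1
      · exact h1
      · rw [← h1, hω] at h; linarith
    refine ⟨s, hs0, lt_of_le_of_lt ?_ h⟩
    have h1 : s ^ γ ≤ 1 := Real.rpow_le_one hs.1 hs.2 hγ0.le
    rw [div_mul_eq_mul_div, div_le_iff₀ (by positivity)]
    have : 1 + c * s ^ γ ≤ 1 + c := by nlinarith
    exact mul_le_mul_of_nonneg_left this hw.le
  have hSpos : ∀ w : ℝ, 0 < w → 0 < M 1 1 w := by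
    intro w hw
    by_contra hcon
    have h0 : M 1 1 w = 0 := le_antisymm (not_lt.1 hcon) (by rw [hMdef]; exact measureReal_nonneg)
    have hn : ∀ n : ℕ, P {ω | ∃ s ∈ Icc (0:ℝ) (n + 1), w * ((n:ℝ) + 1) ^ H < 1 * X s ω} = 0 := by
      intro n
      have hn1 : (0:ℝ) < n + 1 := by positivity
      have h1 := hC 1 (n + 1) (w * ((n:ℝ) + 1) ^ H) hn1
      rw [mul_left_comm, ← Real.rpow_add hn1, neg_add_cancel, Real.rpow_zero, mul_one, h0, hMdef,
        measureReal_eq_zero_iff] at h1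
      exact h1
    have hU := measure_iUnion_null hn
    have hGz : ∀ v, w * (2 ^ H * (1 + 1 / c)) ≤ v → G v = 0 := by
      intro v hv
      rw [hGdef, measureReal_eq_zero_iff]
      refine measure_mono_null ?_ hU
      rintro ω ⟨s, hs, h⟩
      have hs : 0 < s := hs
      refine mem_iUnion.2 ⟨⌊s⌋₊, s, ⟨hs.le, (Nat.lt_floor_add_one s).le⟩, ?_⟩
      rw [one_mul]
      refine lt_of_le_of_lt ?_ h
      have hfl : (⌊s⌋₊ : ℝ) + 1 ≤ s + 1 := by linarith [Nat.floor_le hs.le]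
      have h1 : ((⌊s⌋₊ : ℝ) + 1) ^ H ≤ (s + 1) ^ H := Real.rpow_le_rpow (by positivity) hfl hH.le
      have h2 : (s + 1) ^ H ≤ 2 ^ H * (1 + 1 / c) * (1 + c * s ^ γ) := by
        have hp2 : (0:ℝ) < 2 ^ H := by positivity
        have hsγ : 0 < s ^ γ := by positivity
        have hexp : (1 + 1 / c) * (1 + c * s ^ γ) = 1 + c * s ^ γ + 1 / c + s ^ γ := by field_simp; ring
        have hic : 0 < 1 / c := by positivity
        rw [mul_assoc, hexp]
        rcases le_total s 1 with hs1 | hs1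
        · have : (s + 1) ^ H ≤ 2 ^ H := Real.rpow_le_rpow (by positivity) (by linarith) hH.le
          have h3 : 0 ≤ 2 ^ H * (c * s ^ γ + 1 / c + s ^ γ) := by positivity
          nlinarith
        · have h4 : (s + 1) ^ H ≤ (2 * s) ^ H := Real.rpow_le_rpow (by positivity) (by linarith) hH.le
          rw [Real.mul_rpow (by norm_num) hs.le] at h4
          have h5 : s ^ H ≤ s ^ γ := Real.rpow_le_rpow_of_exponent_le hs1 hγ.le
          have h6 : 2 ^ H * s ^ H ≤ 2 ^ H * s ^ γ := mul_le_mul_of_nonneg_left h5 hp2.le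
          have h3 : 0 ≤ 2 ^ H * (1 + c * s ^ γ + 1 / c) := by positivity
          nlinarith
      calc w * ((⌊s⌋₊ : ℝ) + 1) ^ H ≤ w * (2 ^ H * (1 + 1 / c) * (1 + c * s ^ γ)) :=
            mul_le_mul_of_nonneg_left (h1.trans h2) hw.le
        _ = w * (2 ^ H * (1 + 1 / c)) * (1 + c * s ^ γ) := by ring
        _ ≤ v * (1 + c * s ^ γ) := mul_le_mul_of_nonneg_right hv (hpos1 s hs.le).le
    obtain ⟨x0, hx0⟩ := hGlo (1/2) (by norm_num)
    have h1 := hx0 _ (le_max_left x0 (w * (2 ^ H * (1 + 1 / c))))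
    rw [hGz _ (le_max_right _ _)] at h1
    linarith [hRpos (max x0 (w * (2 ^ H * (1 + 1 / c))))]
  have hI : ∃ C, 0 < C ∧ ∃ w0, ∀ w, w0 ≤ w → M (-1) 1 w ≤ C * M 1 1 w := by
    obtain ⟨C, hC1, hC2⟩ := EReal.lt_iff_exists_real_btwn.1 hcomp
    obtain ⟨w0, hw0⟩ := eventually_atTop.1 (eventually_lt_of_limsup_lt hC1)
    refine ⟨max C 1, by positivity, max w0 1, fun w hw => ?_⟩
    have h := hw0 w ((le_max_left _ _).trans hw)
    rw [EReal.coe_lt_coe_iff] at h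
    have hwp : 0 < w := lt_of_lt_of_le one_pos ((le_max_right _ _).trans hw)
    have e1 : (P {ω | (⨅ s : Icc (0 : ℝ) 1, ((X (s : ℝ) ω : ℝ) : EReal)) < ((-w : ℝ) : EReal)}).toReal = M (-1) 1 w := by
      rw [hMdef, measureReal_def]
      congr 2
      ext ω
      simp only [mem_ofPred_eq, iInf_lt_iff, EReal.coe_lt_coe_iff, Subtype.exists, exists_prop]
      refine exists_congr fun s => and_congr_right fun hs => ?_
      constructor <;> intro h <;> linarith
    have e2 : (P {ω | ((w : ℝ) : EReal) < (⨆ s : Icc (0 : ℝ) 1, ((X (s : ℝ) ω : ℝ) : EReal))}).toReal = M 1 1 w := by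
      rw [hMdef, measureReal_def]
      congr 2
      ext ω
      simp only [mem_ofPred_eq, lt_iSup_iff, EReal.coe_lt_coe_iff, Subtype.exists, exists_prop, one_mul]
    rw [e1, e2, div_lt_iff₀ (hSpos w hwp)] at h
    exact h.le.trans (mul_le_mul_of_nonneg_right (le_max_left _ _) (hSpos w hwp).le)
  have hratio : ∀ τ : ℝ, 0 < τ → ∀ᶠ u in atTop, t u / u ^ (1 / γ) < τ := fun τ hτ =>
    htu.eventually (gt_mem_nhds hτ)
  have hsmall' : ∀ σ : ℝ, (∃ C, 0 < C ∧ ∃ w0, ∀ w, w0 ≤ w → M σ 1 w ≤ C * M 1 1 w) →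
      ∀ δ ε : ℝ, 0 < δ → 0 < ε → ∀ᶠ u in atTop, M σ (t u) (δ * u) ≤ ε * R (u ^ κ) := by
    rintro σ ⟨C, hC0, w0, hw0⟩ δ ε hδ hε
    obtain ⟨K, hK, x0, hx0⟩ := aux_D R hRpos hRanti hPD (ε / (2 * C)) (by positivity)
    obtain ⟨x1, hx1⟩ := hGup 1 one_pos
    set B := K * (1 + c) / δ with hBdef
    have hB0 : 0 < B := by positivity
    have hKt : Tendsto (fun u : ℝ => K * u ^ κ) atTop atTop := hκt.const_mul_atTop hK
    filter_upwards [hratio (B ^ (-(1 / H))) (by positivity), eventually_gt_atTop 0,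
      hκt.eventually_ge_atTop x0, hKt.eventually_ge_atTop x1, hKt.eventually_ge_atTop w0] with u h1 hu h2 h3 h4
    have htp := ht u hu
    have ha : 0 < u ^ (1 / γ) := Real.rpow_pos_of_pos hu _
    have hρ : 0 < t u / u ^ (1 / γ) := div_pos htp ha
    have h5 : B ≤ (t u / u ^ (1 / γ)) ^ (-H) := by
      have := Real.rpow_le_rpow_of_nonpos hρ h1.le (show -H ≤ 0 by linarith)
      rw [← Real.rpow_mul hB0.le] at this
      have e : -(1 / H) * -H = 1 := by field_simp
      rwa [e, Real.rpow_one] at this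
    have h6 : (t u) ^ (-H) * u = (t u / u ^ (1 / γ)) ^ (-H) * u ^ κ := by
      rw [← hau u hu, ← mul_assoc, ← Real.mul_rpow hρ.le ha.le, div_mul_cancel₀ _ ha.ne']
    have hup : 0 < u ^ κ := by positivity
    have h7 : K * u ^ κ ≤ (t u) ^ (-H) * (δ * u) / (1 + c) := by
      rw [le_div_iff₀ (by positivity), mul_left_comm, h6]
      have : B * u ^ κ ≤ (t u / u ^ (1 / γ)) ^ (-H) * u ^ κ := mul_le_mul_of_nonneg_right h5 hup.le
      have h8 := mul_le_mul_of_nonneg_left this hδ.le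
      have e : δ * (B * u ^ κ) = K * u ^ κ * (1 + c) := by rw [hBdef]; field_simp
      linarith
    set w := (t u) ^ (-H) * (δ * u) with hw
    have hwp : 0 < w := by positivity
    have h9 : w / (1 + c) ≤ w := div_le_self hwp.le (by linarith)
    rw [hC σ _ _ htp]
    have a1 := hw0 w (by linarith)
    have a2 := hSG w hwp
    have a3 := hx1 (w / (1 + c)) (by linarith)
    have a4 := hRanti h7
    have a5 := hx0 _ h2
    calc M σ 1 w ≤ C * M 1 1 w := a1
      _ ≤ C * ((1 + 1) * (ε / (2 * C) * R (u ^ κ))) := by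
        refine mul_le_mul_of_nonneg_left ?_ hC0.le
        linarith
      _ = ε * R (u ^ κ) := by field_simp; ring
  have hsm1 := hsmall' 1 ⟨1, one_pos, 0, fun w _ => by rw [one_mul]⟩
  have hsm2 := hsmall' (-1) hI
  clear hsmall'
  set U : ℝ → ℝ := fun u => (P {ω | (u : EReal) < ⨆ s : Icc (0 : ℝ) (t u), Y (s : ℝ) ω}).toReal with hU
  set L : ℝ → ℝ := fun u => (P {ω | (u : EReal) < ⨅ s : Icc (0 : ℝ) (t u), Y (s : ℝ) ω}).toReal with hL
  have hLU : ∀ u, 0 < u → L u ≤ U u := by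
    intro u hu
    refine ENNReal.toReal_mono (measure_ne_top _ _) (measure_mono ?_)
    intro ω h
    have h' : (u : EReal) < ⨅ s : Icc (0 : ℝ) (t u), Y (s : ℝ) ω := h
    exact (h'.trans_le (iInf_le _ ⟨0, le_rfl, (ht u hu).le⟩)).trans_le
      (le_iSup (fun s : Icc (0 : ℝ) (t u) => Y (s : ℝ) ω) ⟨0, le_rfl, (ht u hu).le⟩)
  have hUb : ∀ ε : ℝ, 0 < ε → ∀ᶠ u in atTop, U u ≤ ((1 + ε) * (1 + ε) + ε) * R (u ^ κ) := by
    intro ε hε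
    obtain ⟨n, x0, hn⟩ := aux_E R hRpos hRv ε hε
    obtain ⟨x1, hx1⟩ := hGup ε hε
    set η : ℝ := 1 / (n + 2) with hη
    have hη0 : 0 < η := by positivity
    have hη1 : η < 1 := by
      rw [hη, div_lt_one (by positivity)]
      have : (0:ℝ) ≤ n := by positivity
      linarith
    obtain ⟨C, hC0, hCF⟩ := aux_F γ hγ0 η hη0 hη1
    have hθt : Tendsto (fun u : ℝ => (1 - η) * u ^ κ) atTop atTop := hκt.const_mul_atTop (by linarith)
    filter_upwards [hsm2 (η / 2) ε (by positivity) hε, eventually_gt_atTop 0,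
      hratio ((η / 2 / (c * C)) ^ (1 / γ)) (by positivity), hκt.eventually_ge_atTop x0,
      hθt.eventually_ge_atTop x1] with u h1 hu h2 h3 h4
    have htp := ht u hu
    have ha : 0 < u ^ (1 / γ) := Real.rpow_pos_of_pos hu _
    have htγ : c * C * (t u) ^ γ ≤ η / 2 * u := by
      rw [div_lt_iff₀ ha, ← Real.mul_rpow (by positivity) hu.le] at h2
      have := Real.rpow_le_rpow htp.le h2.le hγ0.le
      rw [← Real.rpow_mul (by positivity), one_div_mul_cancel hγ0.ne', Real.rpow_one] at this
      calc c * C * (t u) ^ γ ≤ c * C * (η / 2 / (c * C) * u) := mul_le_mul_of_nonneg_left this (by positivity)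
        _ = _ := by field_simp
    have hsub : {ω | (u : EReal) < ⨆ s : Icc (0 : ℝ) (t u), Y (s : ℝ) ω} ⊆
        {ω | ∃ r ∈ Ioi (0:ℝ), (1 - η) * (u + c * r ^ γ) < X r ω} ∪
        {ω | ∃ s ∈ Icc (0:ℝ) (t u), η / 2 * u < -1 * X s ω} := by
      intro ω h
      simp only [mem_ofPred_eq, lt_iSup_iff, hY, EReal.coe_lt_coe_iff, Subtype.exists, exists_prop] at h
      obtain ⟨s, hs, r, hr, h⟩ := h
      rcases Classical.em (∃ s ∈ Icc (0:ℝ) (t u), η / 2 * u < -1 * X s ω) with hb | hb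
      · exact Or.inr hb
      · left
        push Not at hb
        have hb1 := hb s hs
        have hr0 : 0 < r := by
          rcases (hs.1.trans hr).lt_or_eq with h5 | h5
          · exact h5
          · have : s = r := le_antisymm hr (by rw [← h5]; exact hs.1)
            rw [this, sub_self, sub_self, Real.zero_rpow hγ0.ne'] at h
            linarith
        refine ⟨r, hr0, ?_⟩
        have h5 := mul_le_mul_of_nonneg_left (hCF s (t u) r hs.1 hs.2 hr) hc.le
        linarith
    have h5 : U u ≤ G ((1 - η) * u ^ κ) + M (-1) (t u) (η / 2 * u) := by
      rw [← hB u (1 - η) hu, hMdef]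
      exact (measureReal_mono hsub).trans (measureReal_union_le _ _)
    have h6 := hx1 _ h4
    have h7 := hn _ h3
    have e : u ^ κ - u ^ κ / (n + 2) = (1 - η) * u ^ κ := by rw [hη]; ring
    rw [e] at h7
    have h8 := mul_le_mul_of_nonneg_left h7 (show 0 ≤ 1 + ε by linarith)
    linarith
  have hLb : ∀ ε : ℝ, 0 < ε → ε < 1 → ∀ᶠ u in atTop, ((1 - ε) * (1 / (1 + ε)) - ε) * R (u ^ κ) ≤ L u := by
    intro ε hε hε1
    obtain ⟨n, x0, hn⟩ := aux_E R hRpos hRv ε hε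
    obtain ⟨x1, hx1⟩ := hGlo ε hε
    set η : ℝ := 1 / (n + 2) with hη
    have hη0 : 0 < η := by positivity
    have hη1 : η < 1 := by
      rw [hη, div_lt_one (by positivity)]
      have : (0:ℝ) ≤ n := by positivity
      linarith
    set θ : ℝ := 1 / (1 - η) with hθ
    have h1η : 0 < 1 - η := by linarith
    have hθ1 : 1 < θ := by rw [hθ, lt_div_iff₀ h1η]; linarith
    have hθt : Tendsto (fun u : ℝ => θ * u ^ κ) atTop atTop := hκt.const_mul_atTop (by linarith)
    set δ : ℝ := (θ - 1) / 2 with hδ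
    have hδ0 : 0 < δ := by rw [hδ]; linarith
    filter_upwards [hsm1 δ ε hδ0 hε, eventually_gt_atTop 0, hθt.eventually_ge_atTop x0,
      hθt.eventually_ge_atTop x1] with u h1 hu h3 h4
    have htp := ht u hu
    have hsub : {ω | ∃ r ∈ Ioi (0:ℝ), θ * (u + c * r ^ γ) < X r ω} ⊆
        {ω | (u : EReal) < ⨅ s : Icc (0 : ℝ) (t u), Y (s : ℝ) ω} ∪
        {ω | ∃ s ∈ Icc (0:ℝ) (t u), δ * u < 1 * X s ω} := by
      rintro ω ⟨r, hr, h⟩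
      have hr : 0 < r := hr
      rcases Classical.em (∃ s ∈ Icc (0:ℝ) (t u), δ * u < 1 * X s ω) with hb | hb
      · exact Or.inr hb
      · left
        push Not at hb
        have hrγ : 0 ≤ c * r ^ γ := by positivity
        have hθr : c * r ^ γ ≤ θ * (c * r ^ γ) := by nlinarith
        have hθu : θ * u = u + 2 * (δ * u) := by rw [hδ]; ring
        have hδu : 0 < δ * u := by positivity
        have hrt : t u < r := by
          by_contra hcon
          have := hb r ⟨hr.le, not_lt.1 hcon⟩
          linarith
        have hlt : (u : EReal) < ((u + δ * u : ℝ) : EReal) := by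
          rw [EReal.coe_lt_coe_iff]; linarith
        refine lt_of_lt_of_le hlt (le_iInf ?_)
        rintro ⟨s, hs⟩
        have hsr : s ≤ r := hs.2.trans hrt.le
        rw [hY]
        refine le_iSup_of_le ⟨r, hsr⟩ ?_
        rw [EReal.coe_le_coe_iff]
        have h5 := hb s hs
        have h6 : (r - s) ^ γ ≤ r ^ γ := Real.rpow_le_rpow (by linarith) (by linarith [hs.1]) hγ0.le
        have h7 := mul_le_mul_of_nonneg_left h6 hc.le
        simp only
        linarith
    have h5 : G (θ * u ^ κ) ≤ L u + M 1 (t u) (δ * u) := by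
      rw [← hB u θ hu, hMdef]
      exact (measureReal_mono hsub).trans (measureReal_union_le _ _)
    have h6 := hx1 _ h4
    have h7 := hn _ h3
    have e : θ * u ^ κ - θ * u ^ κ / (n + 2) = u ^ κ := by
      have : θ * (1 - η) = 1 := by rw [hθ]; field_simp
      calc _ = (θ * (1 - η)) * u ^ κ := by rw [hη]; ring
        _ = _ := by rw [this, one_mul]
    rw [e] at h7
    have h8 : 1 / (1 + ε) * R (u ^ κ) ≤ R (θ * u ^ κ) := by
      rw [one_div, ← div_eq_inv_mul, div_le_iff₀ (by linarith)]; linarith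
    have h9 := mul_le_mul_of_nonneg_left h8 (show 0 ≤ 1 - ε by linarith)
    linarith
  have hnear : ∀ e : ℝ, 0 < e → ∃ ε, 0 < ε ∧ ε < 1 ∧ (1 + ε) * (1 + ε) + ε < 1 + e ∧
      1 - e < (1 - ε) * (1 / (1 + ε)) - ε := by
    intro e he
    refine ⟨min (1/2) (e / 5), by positivity, by linarith [min_le_left (1/2) (e/5)], ?_, ?_⟩
    all_goals
      have h1 := min_le_left (1/2) (e/5)
      have h2 := min_le_right (1/2) (e/5)
      have h3 : 0 < min (1/2) (e/5) := by positivity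
      generalize min (1/2) (e/5) = x at *
    · nlinarith
    · have h4 : 1 - x ≤ 1 / (1 + x) := by
        rw [le_div_iff₀ (by linarith)]; nlinarith
      nlinarith
  have hT : ∀ F : ℝ → ℝ, (∀ u, 0 < u → L u ≤ F u ∧ F u ≤ U u) →
      Tendsto (fun u => F u / R (u ^ κ)) atTop (nhds 1) := by
    intro F hF
    rw [Metric.tendsto_nhds]
    intro e he
    obtain ⟨ε, hε, hε1, h1, h2⟩ := hnear e he
    filter_upwards [hUb ε hε, hLb ε hε hε1, eventually_gt_atTop 0] with u h3 h4 hu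
    have hp := hRpos (u ^ κ)
    rw [Real.dist_eq, abs_lt]
    have h5 : F u / R (u ^ κ) ≤ (1 + ε) * (1 + ε) + ε := by
      rw [div_le_iff₀ hp]; linarith [(hF u hu).2]
    have h6 : (1 - ε) * (1 / (1 + ε)) - ε ≤ F u / R (u ^ κ) := by
      rw [le_div_iff₀ hp]; linarith [(hF u hu).1]
    constructor <;> linarith
  have hfin := (hT U fun u hu => ⟨hLU u hu, le_rfl⟩).div (hT L fun u hu => ⟨le_rfl, hLU u hu⟩) one_ne_zero
  rw [div_one] at hfin
  refine hfin.congr fun u => ?_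
  exact div_div_div_cancel_right₀ (hRpos _).ne' _ _
end
end

section
/- For all real constants c > 0 and γ > 0, there exists C > 0 such that for every δ ∈ [0, 1] and every real s ≥ δ: 1 + c (s − δ)^γ ≥ (1 − C δ^{min(γ,1)}) (1 + c s^γ). -/
open Set

theorem ratio_bound_small_shift (c γ : ℝ) (hc : 0 < c) (hγ : 0 < γ) :
    ∃ C : ℝ, 0 < C ∧ ∀ δ ∈ Icc (0 : ℝ) 1, ∀ s : ℝ, δ ≤ s →
      (1 - C * δ ^ min γ 1) * (1 + c * s ^ γ) ≤ 1 + c * (s - δ) ^ γ := by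
  rcases le_total γ 1 with h1 | h1
  · refine ⟨c, hc, ?_⟩
    rintro δ ⟨h0, -⟩ s hs
    rw [min_eq_left h1]
    have h := NNReal.rpow_add_le_add_rpow ⟨s - δ, sub_nonneg.2 hs⟩ ⟨δ, h0⟩ hγ.le h1
    have h' : (s - δ + δ) ^ γ ≤ (s - δ) ^ γ + δ ^ γ := by exact_mod_cast h
    rw [sub_add_cancel] at h'
    have hp : 0 ≤ c * δ ^ γ * (c * s ^ γ) := by
      have := Real.rpow_nonneg h0 γ
      have := Real.rpow_nonneg (h0.trans hs) γ
      positivity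
    nlinarith [mul_le_mul_of_nonneg_left h' hc.le]
  · refine ⟨γ * (c + 1), by positivity, ?_⟩
    rintro δ ⟨h0, -⟩ s hs
    rw [min_eq_right h1, Real.rpow_one]
    rcases (h0.trans hs).eq_or_lt with hs0 | hs0
    · have : δ = 0 := by linarith
      subst this
      simp
    have hb := one_add_mul_self_le_rpow_one_add (s := -(δ / s))
      (by have := (div_le_one hs0).2 hs; linarith) h1
    have hd : 0 ≤ 1 + -(δ / s) := by have := (div_le_one hs0).2 hs; linarith
    have e : (s - δ) ^ γ = s ^ γ * (1 + -(δ / s)) ^ γ := by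
      rw [← Real.mul_rpow hs0.le hd]
      congr 1
      field_simp
      ring
    have hsp := Real.rpow_pos_of_pos hs0 γ
    have hq : s ^ γ / s ≤ 1 + s ^ γ := by
      rcases le_total s 1 with h | h
      · have : s ^ γ ≤ s ^ (1:ℝ) := Real.rpow_le_rpow_of_exponent_ge hs0 h h1
        rw [Real.rpow_one] at this
        have := (div_le_one hs0).2 this
        linarith
      · have := div_le_self hsp.le h
        linarith
    have h2 : s ^ γ - γ * δ * (s ^ γ / s) ≤ (s - δ) ^ γ := by
      rw [e]
      refine le_trans (le_of_eq ?_) (mul_le_mul_of_nonneg_left hb hsp.le)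
      field_simp
      ring
    have hgd : 0 ≤ γ * δ := by positivity
    have h3 := mul_le_mul_of_nonneg_left hq (mul_nonneg hc.le hgd)
    have h4 := mul_le_mul_of_nonneg_left h2 hc.le
    have h5 : 0 ≤ γ * δ * (1 + c * (c * s ^ γ)) := by positivity
    nlinarith
end

section
/- Let c > 0, γ > 0, K > 0 be real constants and let θ ∈ (0, 1) satisfy 1 + c (s − r)^γ ≥ θ (1 + c s^γ) for all 0 ≤ r ≤ K and s ≥ r. Then for every function x : [0, ∞) → ℝ and every δ ∈ [0, K]: sup_{0 ≤ r ≤ δ} sup_{s ≥ r} (x(s) − x(r)) / (1 + c (s − r)^γ) ≤ θ^{−1} ( sup_{s ≥ 0} x(s) / (1 + c s^γ) + sup_{0 ≤ r ≤ δ} max(−x(r), 0) ), where all suprema are taken in the extended reals [−∞, +∞]. -/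
open Set

theorem pathwise_sup_bound (c γ K θ : ℝ) (hc : 0 < c) (hγ : 0 < γ) (hK : 0 < K)
    (hθ : θ ∈ Ioo (0 : ℝ) 1)
    (hθ' : ∀ r : ℝ, 0 ≤ r → r ≤ K → ∀ s : ℝ, r ≤ s →
      θ * (1 + c * s ^ γ) ≤ 1 + c * (s - r) ^ γ) :
    ∀ x : ℝ → ℝ, ∀ δ ∈ Icc (0 : ℝ) K,
      (⨆ r : Icc (0 : ℝ) δ, ⨆ s : {s : ℝ // (r : ℝ) ≤ s},
          (((x (s : ℝ) - x (r : ℝ)) / (1 + c * ((s : ℝ) - (r : ℝ)) ^ γ) : ℝ) : EReal)) ≤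
        ((θ⁻¹ : ℝ) : EReal) *
          ((⨆ s : {s : ℝ // (0 : ℝ) ≤ s}, ((x (s : ℝ) / (1 + c * (s : ℝ) ^ γ) : ℝ) : EReal)) +
            ⨆ r : Icc (0 : ℝ) δ, ((max (-x (r : ℝ)) 0 : ℝ) : EReal)) := by
  intro x δ hδ
  obtain ⟨h0, h1⟩ := hθ
  obtain ⟨hδ0, hδK⟩ := hδ
  have hA : ∀ s : ℝ, 0 ≤ s → ((x s / (1 + c * s ^ γ) : ℝ) : EReal) ≤
      (⨆ s : {s : ℝ // (0 : ℝ) ≤ s}, ((x (s : ℝ) / (1 + c * (s : ℝ) ^ γ) : ℝ) : EReal)) :=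
    fun s hs => le_iSup (fun s : {s : ℝ // (0 : ℝ) ≤ s} =>
      ((x (s : ℝ) / (1 + c * (s : ℝ) ^ γ) : ℝ) : EReal)) ⟨s, hs⟩
  have hB : ∀ r : ℝ, 0 ≤ r → r ≤ δ → ((max (-x r) 0 : ℝ) : EReal) ≤
      ⨆ r : Icc (0 : ℝ) δ, ((max (-x (r : ℝ)) 0 : ℝ) : EReal) :=
    fun r hr hr' => le_iSup (fun r : Icc (0 : ℝ) δ =>
      ((max (-x (r : ℝ)) 0 : ℝ) : EReal)) ⟨r, hr, hr'⟩
  generalize (⨆ s : {s : ℝ // (0 : ℝ) ≤ s},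
    ((x (s : ℝ) / (1 + c * (s : ℝ) ^ γ) : ℝ) : EReal)) = A at hA ⊢
  generalize (⨆ r : Icc (0 : ℝ) δ, ((max (-x (r : ℝ)) 0 : ℝ) : EReal)) = B at hB ⊢
  have hi : 0 < θ⁻¹ := inv_pos.mpr h0
  have hAb : A ≠ ⊥ := fun h => by
    have := hA 0 le_rfl
    rw [h, le_bot_iff] at this
    exact EReal.coe_ne_bot _ this
  have hBb : B ≠ ⊥ := fun h => by
    have := hB 0 le_rfl hδ0
    rw [h, le_bot_iff] at this
    exact EReal.coe_ne_bot _ this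
  by_cases hAt : A = ⊤
  · rw [hAt, EReal.top_add_of_ne_bot hBb, EReal.coe_mul_top_of_pos hi]
    exact le_top
  by_cases hBt : B = ⊤
  · rw [hBt, EReal.add_top_of_ne_bot hAb, EReal.coe_mul_top_of_pos hi]
    exact le_top
  lift A to ℝ using ⟨hAt, hAb⟩
  lift B to ℝ using ⟨hBt, hBb⟩
  simp only [EReal.coe_le_coe_iff] at hA hB
  refine iSup_le fun ⟨r, hr0, hrδ⟩ => iSup_le fun ⟨s, hs⟩ => ?_
  rw [← EReal.coe_add, ← EReal.coe_mul, EReal.coe_le_coe_iff]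
  simp only at hs ⊢
  have hs0 : 0 ≤ s := hr0.trans hs
  have hD := hθ' r hr0 (hrδ.trans hδK) s hs
  have hE : 0 ≤ c * s ^ γ := mul_nonneg hc.le (Real.rpow_nonneg hs0 _)
  have hAs := hA s hs0
  rw [div_le_iff₀ (by linarith)] at hAs
  have hBr := (le_max_left _ _).trans (hB r hr0 hrδ)
  have hB0 := (le_max_right _ _).trans (hB r hr0 hrδ)
  have hA0 := hA 0 le_rfl
  rw [Real.zero_rpow hγ.ne', mul_zero, add_zero, div_one] at hA0
  have hB0' := (le_max_left _ _).trans (hB 0 le_rfl hδ0)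
  have hAB : 0 ≤ A + B := by linarith
  have hDpos : 0 < 1 + c * (s - r) ^ γ :=
    lt_of_lt_of_le (mul_pos h0 (by linarith)) hD
  rw [div_le_iff₀ hDpos]
  have h2 : 1 + c * s ^ γ ≤ θ⁻¹ * (1 + c * (s - r) ^ γ) := by
    rw [inv_mul_eq_div, le_div_iff₀ h0]; linarith
  have h3 := mul_le_mul_of_nonneg_left h2 hAB
  have h4 := mul_nonneg hB0 hE
  nlinarith
end

section
/- For all real constants c > 0, γ > 0, every δ ≥ 0, and every function x : [0, ∞) → ℝ: inf_{0 ≤ r ≤ δ} sup_{s ≥ r} (x(s) − x(r)) / (1 + c (s − r)^γ) ≥ max( sup_{s ≥ δ} x(s) / (1 + c s^γ), 0 ) − sup_{0 ≤ r ≤ δ} max(x(r), 0), where all suprema and infima are taken in the extended reals [−∞, +∞]. -/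
open Set

theorem pathwise_inf_bound (c γ : ℝ) (hc : 0 < c) (hγ : 0 < γ) :
    ∀ δ : ℝ, 0 ≤ δ → ∀ x : ℝ → ℝ,
      max (⨆ s : {s : ℝ // δ ≤ s}, ((x (s : ℝ) / (1 + c * (s : ℝ) ^ γ) : ℝ) : EReal)) 0 -
          (⨆ r : Icc (0 : ℝ) δ, ((max (x (r : ℝ)) 0 : ℝ) : EReal)) ≤
        ⨅ r : Icc (0 : ℝ) δ, ⨆ s : {s : ℝ // (r : ℝ) ≤ s},
          (((x (s : ℝ) - x (r : ℝ)) / (1 + c * ((s : ℝ) - (r : ℝ)) ^ γ) : ℝ) : EReal) := by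
  intro δ hδ x
  refine le_iInf fun r => ?_
  obtain ⟨hr0, hrδ⟩ := r.2
  have hM : ((max (x (r : ℝ)) 0 : ℝ) : EReal) ≤
      ⨆ r : Icc (0 : ℝ) δ, ((max (x (r : ℝ)) 0 : ℝ) : EReal) :=
    le_iSup (fun r : Icc (0 : ℝ) δ => ((max (x (r : ℝ)) 0 : ℝ) : EReal)) r
  refine (EReal.sub_le_sub le_rfl hM).trans ?_
  have hA : ∀ s : ℝ, (r : ℝ) ≤ s →
      (((x s - x (r : ℝ)) / (1 + c * (s - (r : ℝ)) ^ γ) : ℝ) : EReal) ≤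
      ⨆ s : {s : ℝ // (r : ℝ) ≤ s},
          (((x (s : ℝ) - x (r : ℝ)) / (1 + c * ((s : ℝ) - (r : ℝ)) ^ γ) : ℝ) : EReal) :=
    fun s hs => le_iSup (fun s : {s : ℝ // (r : ℝ) ≤ s} =>
          (((x (s : ℝ) - x (r : ℝ)) / (1 + c * ((s : ℝ) - (r : ℝ)) ^ γ) : ℝ) : EReal)) ⟨s, hs⟩
  generalize (⨆ s : {s : ℝ // (r : ℝ) ≤ s},
          (((x (s : ℝ) - x (r : ℝ)) / (1 + c * ((s : ℝ) - (r : ℝ)) ^ γ) : ℝ) : EReal)) = A at hA ⊢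
  have hA0 : (0 : EReal) ≤ A := by simpa using hA r le_rfl
  have hm0 : (0 : ℝ) ≤ max (x (r : ℝ)) 0 := le_max_right _ _
  have hmx : x (r : ℝ) ≤ max (x (r : ℝ)) 0 := le_max_left _ _
  generalize max (x (r : ℝ)) 0 = m at hm0 hmx ⊢
  have hm0' : (0 : EReal) ≤ (m : EReal) := by exact_mod_cast hm0
  rw [EReal.sub_le_iff_le_add (Or.inl (EReal.coe_ne_bot _)) (Or.inl (EReal.coe_ne_top _))]
  refine max_le (iSup_le ?_) (add_nonneg hA0 hm0')
  rintro ⟨s, hs⟩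
  have hrs : (r : ℝ) ≤ s := hrδ.trans hs
  have hp : (s - (r : ℝ)) ^ γ ≤ s ^ γ :=
    Real.rpow_le_rpow (by linarith) (by linarith) hγ.le
  have hp0 : 0 ≤ (s - (r : ℝ)) ^ γ := Real.rpow_nonneg (by linarith) _
  have hD' : 0 < 1 + c * (s - (r : ℝ)) ^ γ := by positivity
  have hDD : 1 + c * (s - (r : ℝ)) ^ γ ≤ 1 + c * s ^ γ := by gcongr
  have hD1 : 1 ≤ 1 + c * s ^ γ := by
    have := mul_nonneg hc.le (hp0.trans hp)
    linarith
  have hD : 0 < 1 + c * s ^ γ := by linarith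
  have hmD : m / (1 + c * s ^ γ) ≤ m := div_le_self hm0 hD1
  rcases le_total (x s) (x (r : ℝ)) with h | h
  · have h1 : x s / (1 + c * s ^ γ) ≤ m :=
      (div_le_div_of_nonneg_right (h.trans hmx) hD.le).trans hmD
    calc ((x s / (1 + c * s ^ γ) : ℝ) : EReal) ≤ (m : EReal) := by exact_mod_cast h1
      _ ≤ A + m := le_add_of_nonneg_left hA0
  · have h1 : x s / (1 + c * s ^ γ) ≤
        (x s - x (r : ℝ)) / (1 + c * (s - (r : ℝ)) ^ γ) + m := by
      have h2 : (x s - x (r : ℝ)) / (1 + c * s ^ γ) ≤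
          (x s - x (r : ℝ)) / (1 + c * (s - (r : ℝ)) ^ γ) :=
        div_le_div_of_nonneg_left (by linarith) hD' hDD
      have h3 : x (r : ℝ) / (1 + c * s ^ γ) ≤ m / (1 + c * s ^ γ) :=
        div_le_div_of_nonneg_right hmx hD.le
      rw [sub_div] at h2
      linarith
    calc ((x s / (1 + c * s ^ γ) : ℝ) : EReal)
        ≤ (((x s - x (r : ℝ)) / (1 + c * (s - (r : ℝ)) ^ γ) + m : ℝ) : EReal) :=
          EReal.coe_le_coe_iff.2 h1
      _ = (((x s - x (r : ℝ)) / (1 + c * (s - (r : ℝ)) ^ γ) : ℝ) : EReal) + m :=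
          EReal.coe_add _ _
      _ ≤ A + m := add_le_add_left (hA s hrs) _
end

section
/- Let R : ℝ → (0, ∞) be nonincreasing and satisfy lim_{u→∞} R(u + λ)/R(u) = 1 for every λ > 0. Then there exists a nondecreasing function v : ℝ → [1, ∞) with lim_{u→∞} v(u) = ∞, limsup_{u→∞} v(u)/u < ∞, and lim_{u→∞} R(u − v(u))/R(u) = 1. -/
open Filter

theorem long_tailed_insensitivity_function (R : ℝ → ℝ) (hRpos : ∀ u, 0 < R u)
    (hRanti : Antitone R)
    (hL : ∀ l : ℝ, 0 < l → Tendsto (fun u : ℝ => R (u + l) / R u) atTop (nhds 1)) :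
    ∃ v : ℝ → ℝ, (∀ u, 1 ≤ v u) ∧ Monotone v ∧ Tendsto v atTop atTop ∧
      limsup (fun u : ℝ => ((v u / u : ℝ) : EReal)) atTop < ⊤ ∧
      Tendsto (fun u : ℝ => R (u - v u) / R u) atTop (nhds 1) := by
  classical
  have h1 : ∀ n : ℕ, ∃ B : ℝ, ∀ u, B ≤ u →
      R (u - ((n : ℝ) + 1)) / R u ≤ 1 + 1 / ((n : ℝ) + 1) := by
    intro n
    have hn : (0 : ℝ) < (n : ℝ) + 1 := by positivity
    have ht : Tendsto (fun u : ℝ => u - ((n : ℝ) + 1)) atTop atTop :=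
      tendsto_atTop_add_const_right atTop (-((n : ℝ) + 1)) tendsto_id
    have h2 := (((hL _ hn).comp ht).inv₀ one_ne_zero)
    have h3 : (1 : ℝ)⁻¹ < 1 + 1 / ((n : ℝ) + 1) := by
      have : 0 < 1 / ((n : ℝ) + 1) := by positivity
      rw [inv_one]; linarith
    obtain ⟨B, hB⟩ := eventually_atTop.1 (h2.eventually_le_const h3)
    refine ⟨B, fun u hu => ?_⟩
    have := hB u hu
    simpa using this
  choose B hB using h1
  let N : ℝ → ℕ := fun u => Nat.findGreatest (fun k => max (k : ℝ) (B k) ≤ u) ⌊u⌋₊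
  have hNmono : Monotone N := by
    intro a b hab
    exact Nat.findGreatest_mono (fun k hk => le_trans hk hab) (Nat.floor_mono hab)
  have hNle : ∀ u, 0 ≤ u → (N u : ℝ) ≤ u := fun u hu =>
    le_trans (Nat.cast_le.2 (Nat.findGreatest_le _)) (Nat.floor_le hu)
  have hNge : ∀ (k : ℕ) u, max (k : ℝ) (B k) ≤ u → k ≤ N u := fun k u hu =>
    Nat.le_findGreatest (Nat.le_floor (le_trans (le_max_left _ _) hu)) hu
  have hNspec : ∀ u, max ((0 : ℕ) : ℝ) (B 0) ≤ u → B (N u) ≤ u := fun u hu =>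
    le_trans (le_max_right _ _)
      (Nat.findGreatest_spec (P := fun k : ℕ => max (k : ℝ) (B k) ≤ u) (Nat.zero_le ⌊u⌋₊) hu)
  have hNtop : Tendsto N atTop atTop :=
    tendsto_atTop.2 fun k => (eventually_ge_atTop _).mono fun u hu => hNge k u hu
  refine ⟨fun u => (N u : ℝ) + 1, fun u => ?_, ?_, ?_, ?_, ?_⟩
  · have : (0 : ℝ) ≤ N u := Nat.cast_nonneg _
    linarith
  · intro a b hab
    have : (N a : ℝ) ≤ N b := Nat.cast_le.2 (hNmono hab)
    simpa using hNmono hab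
  · exact tendsto_atTop_add_const_right _ _ (tendsto_natCast_atTop_atTop.comp hNtop)
  · refine lt_of_le_of_lt (b := ((2 : ℝ) : EReal)) ?_ (EReal.coe_lt_top 2)
    refine limsup_le_of_le (by isBoundedDefault) ?_
    filter_upwards [eventually_ge_atTop (1 : ℝ)] with u hu
    refine EReal.coe_le_coe_iff.2 ?_
    rw [div_le_iff₀ (by linarith)]
    have := hNle u (by linarith)
    linarith
  · have hlim : Tendsto (fun u => 1 + 1 / ((N u : ℝ) + 1)) atTop (nhds 1) := by
      have := (tendsto_one_div_add_atTop_nhds_zero_nat (𝕜 := ℝ)).comp hNtop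
      simpa using this.const_add 1
    refine tendsto_of_tendsto_of_tendsto_of_le_of_le' tendsto_const_nhds hlim ?_ ?_
    · refine Eventually.of_forall fun u => ?_
      rw [one_le_div (hRpos u)]
      apply hRanti
      have : (0 : ℝ) ≤ N u := Nat.cast_nonneg _
      linarith
    · filter_upwards [eventually_ge_atTop (max ((0 : ℕ) : ℝ) (B 0))] with u hu
      exact hB (N u) u (hNspec u hu)
end

section
/- Let ρ > 0 and let r : (0, ∞) → (0, ∞) be nonincreasing, bounded, and regularly varying at infinity with index −ρ (that is, r(λu)/r(u) → λ^{−ρ} as u → ∞ for every λ > 0). Let σ : (0, ∞) → (0, ∞) be measurable and suppose there exists ε > 0 such that ∫₀^∞ σ(s)^{−(ρ+δ)} ds/s < ∞ for every δ ∈ [−ε, ε]. Then ∫₀^∞ r(σ(s) u) ds/s is finite for all sufficiently large u, and lim_{u→∞} ( ∫₀^∞ r(σ(s) u) ds/s ) / r(u) = ∫₀^∞ σ(s)^{−ρ} ds/s. -/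
open MeasureTheory Filter Set

noncomputable section

lemma potter_aux (ρ : ℝ) (r : ℝ → ℝ)
    (hrpos : ∀ x : ℝ, 0 < x → 0 < r x)
    (hranti : AntitoneOn r (Ioi 0))
    (hrbdd : ∃ M : ℝ, ∀ x : ℝ, 0 < x → r x ≤ M)
    (hrRV : ∀ l : ℝ, 0 < l → Tendsto (fun u : ℝ => r (l * u) / r u) atTop (nhds (l ^ (-ρ))))
    (p q : ℝ) (hp : 0 ≤ p) (hpρ : p < ρ) (hq : ρ < q) :
    ∃ X > 0, ∃ C : ℝ, ∀ u, X ≤ u → ∀ l, 0 < l →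
      r (l * u) / r u ≤ C * (l ^ (-p) + l ^ (-q)) := by
  have hq0 : 0 ≤ q := by linarith
  have h1 : ∀ᶠ u in atTop, r (2 * u) / r u < 2 ^ (-p) :=
    (hrRV 2 two_pos).eventually_lt_const (Real.rpow_lt_rpow_of_exponent_lt one_lt_two (by linarith))
  have h2 : ∀ᶠ u in atTop, (2:ℝ) ^ (-q) < r (2 * u) / r u :=
    (hrRV 2 two_pos).eventually_const_lt (Real.rpow_lt_rpow_of_exponent_lt one_lt_two (by linarith))
  obtain ⟨X0, hX0⟩ := eventually_atTop.1 (h1.and h2)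
  obtain ⟨M, hM⟩ := hrbdd
  set X := max X0 1 with hX
  have hXpos : 0 < X := lt_of_lt_of_le one_pos (le_max_right _ _)
  have hstep : ∀ u, X ≤ u → r (2 * u) ≤ 2 ^ (-p) * r u ∧ 2 ^ (-q) * r u ≤ r (2 * u) := by
    intro u hu
    have hu0 : 0 < u := by linarith
    obtain ⟨a, b⟩ := hX0 u ((le_max_left _ _).trans hu)
    exact ⟨((div_lt_iff₀ (hrpos u hu0)).1 a).le, ((lt_div_iff₀ (hrpos u hu0)).1 b).le⟩
  have hpow : ∀ n : ℕ, ∀ u, X ≤ u → r (2 ^ n * u) ≤ (2 ^ n : ℝ) ^ (-p) * r u ∧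
      (2 ^ n : ℝ) ^ (-q) * r u ≤ r (2 ^ n * u) := by
    intro n
    induction n with
    | zero => intro u hu; simp
    | succ n ih =>
      intro u hu
      obtain ⟨a, b⟩ := ih u hu
      have hu0 : 0 < u := by linarith
      have h1n : (1:ℝ) ≤ 2 ^ n := one_le_pow₀ (by norm_num)
      obtain ⟨c, d⟩ := hstep (2 ^ n * u) (by nlinarith)
      have e : (2:ℝ) ^ (n+1) * u = 2 * (2 ^ n * u) := by ring
      have f : ∀ t : ℝ, ((2:ℝ) ^ (n+1)) ^ t = 2 ^ t * (2 ^ n : ℝ) ^ t := by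
        intro t; rw [pow_succ', Real.mul_rpow (by norm_num) (by positivity)]
      rw [e, f, f, mul_assoc, mul_assoc]
      exact ⟨c.trans (by gcongr), le_trans (by gcongr) d⟩
  have hup : ∀ u, X ≤ u → ∀ l, 1 ≤ l → r (l * u) ≤ (l / 2) ^ (-p) * r u := by
    intro u hu l hl
    have hu0 : 0 < u := by linarith
    obtain ⟨n, hn1, hn2⟩ := exists_nat_pow_near hl one_lt_two
    have h2n : (0:ℝ) < 2 ^ n := by positivity
    calc r (l * u) ≤ r (2 ^ n * u) :=
          hranti (mem_Ioi.2 (by positivity)) (mem_Ioi.2 (by positivity)) (by gcongr)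
      _ ≤ _ := (hpow n u hu).1
      _ ≤ _ := mul_le_mul_of_nonneg_right
          (Real.rpow_le_rpow_of_nonpos (by positivity) (by rw [pow_succ] at hn2; linarith)
            (by linarith)) (hrpos u hu0).le
  have hlow : ∀ u, X ≤ u → ∀ l, 1 ≤ l → r u ≤ (2 * l) ^ q * r (l * u) := by
    intro u hu l hl
    have hu0 : 0 < u := by linarith
    obtain ⟨n, hn1, hn2⟩ := exists_nat_pow_near hl one_lt_two
    have h2n : (0:ℝ) < 2 ^ n := by positivity
    have h3 := (hpow (n+1) u hu).2
    have h4 : r (2 ^ (n+1) * u) ≤ r (l * u) :=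
      hranti (mem_Ioi.2 (by positivity)) (mem_Ioi.2 (by positivity)) (by gcongr)
    have h5 : ((2:ℝ) * l) ^ (-q) ≤ (2 ^ (n+1)) ^ (-q) :=
      Real.rpow_le_rpow_of_nonpos (by positivity) (by rw [pow_succ]; linarith) (by linarith)
    have h6 : (2 * l) ^ (-q) * r u ≤ r (l * u) :=
      (mul_le_mul_of_nonneg_right h5 (hrpos u hu0).le).trans (h3.trans h4)
    rw [Real.rpow_neg (by positivity)] at h6
    exact (inv_mul_le_iff₀ (by positivity)).1 h6
  have hrX := hrpos X hXpos
  have hM0 : 0 ≤ M := (hrX.le).trans (hM X hXpos)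
  refine ⟨X, hXpos, 2 ^ p + 2 ^ q * (1 + M / r X), ?_⟩
  intro u hu l hl
  have hu0 : 0 < u := by linarith
  have hru := hrpos u hu0
  have A : 0 < l ^ (-p) := by positivity
  have B : 0 < l ^ (-q) := by positivity
  have P : (0:ℝ) < 2 ^ p := by positivity
  have Q : (0:ℝ) < 2 ^ q := by positivity
  have D : 0 ≤ M / r X := by positivity
  have key : r (l * u) / r u ≤ 2 ^ p * l ^ (-p) ∨ r (l * u) / r u ≤ 2 ^ q * l ^ (-q) ∨
      r (l * u) / r u ≤ 2 ^ q * (M / r X) * l ^ (-q) := by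
    have hinv : (2 * l⁻¹) ^ q = 2 ^ q * l ^ (-q) := by
      rw [Real.mul_rpow (by norm_num) (by positivity), Real.inv_rpow hl.le, Real.rpow_neg hl.le]
    rcases le_or_gt 1 l with h | h
    · left
      have := hup u hu l h
      rw [Real.div_rpow hl.le (by norm_num), Real.rpow_neg zero_le_two, div_inv_eq_mul] at this
      rw [div_le_iff₀ hru]; linarith
    · right
      rcases le_or_gt X (l * u) with h' | h'
      · left
        have := hlow (l * u) h' l⁻¹ ((one_le_inv₀ hl).2 h.le)
        rw [inv_mul_cancel_left₀ hl.ne', hinv] at this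
        rwa [div_le_iff₀ hru]
      · right
        have h7 := hlow X le_rfl (u / X) ((one_le_div hXpos).2 hu)
        rw [div_mul_cancel₀ _ hXpos.ne'] at h7
        have h8 : (2 * (u / X)) ^ q ≤ (2 * l⁻¹) ^ q := by
          apply Real.rpow_le_rpow (by positivity) _ hq0
          gcongr
          rw [div_le_iff₀ hXpos, inv_mul_eq_div, le_div_iff₀ hl]; linarith
        rw [hinv] at h8
        have h9 : r X ≤ 2 ^ q * l ^ (-q) * r u := h7.trans (by gcongr)
        rw [div_le_iff₀ hru]
        calc r (l * u) ≤ M := hM _ (by positivity)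
          _ = M / r X * r X := by field_simp
          _ ≤ M / r X * (2 ^ q * l ^ (-q) * r u) := by gcongr
          _ = _ := by ring
  have a1 := mul_pos P A
  have a2 := mul_pos P B
  have a3 := mul_pos Q A
  have a4 := mul_pos Q B
  have a5 := mul_nonneg (mul_nonneg Q.le D) A.le
  have a6 := mul_nonneg (mul_nonneg Q.le D) B.le
  rcases key with h | h | h <;> nlinarith

theorem regvar_tail_integral (ρ : ℝ) (hρ : 0 < ρ) (r : ℝ → ℝ)
    (hrpos : ∀ x : ℝ, 0 < x → 0 < r x)
    (hranti : AntitoneOn r (Ioi 0))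
    (hrbdd : ∃ M : ℝ, ∀ x : ℝ, 0 < x → r x ≤ M)
    (hrRV : ∀ l : ℝ, 0 < l → Tendsto (fun u : ℝ => r (l * u) / r u) atTop (nhds (l ^ (-ρ))))
    (σ : ℝ → ℝ) (hσmeas : Measurable σ) (hσpos : ∀ s : ℝ, 0 < s → 0 < σ s)
    (hint : ∃ ε : ℝ, 0 < ε ∧ ∀ δ ∈ Icc (-ε) ε,
      IntegrableOn (fun s : ℝ => σ s ^ (-(ρ + δ)) / s) (Ioi 0)) :
    (∀ᶠ u : ℝ in atTop, IntegrableOn (fun s : ℝ => r (σ s * u) / s) (Ioi 0)) ∧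
      Tendsto (fun u : ℝ => (∫ s in Ioi (0 : ℝ), r (σ s * u) / s) / r u) atTop
        (nhds (∫ s in Ioi (0 : ℝ), σ s ^ (-ρ) / s)) := by
  obtain ⟨ε, hε, hint⟩ := hint
  set e := min ε ρ with he
  have he0 : 0 < e := lt_min hε hρ
  have heε : e ≤ ε := min_le_left _ _
  have heρ : e ≤ ρ := min_le_right _ _
  obtain ⟨X, hX, C, hC⟩ := potter_aux ρ r hrpos hranti hrbdd hrRV (ρ + -e) (ρ + e)
    (by linarith) (by linarith) (by linarith)
  have hI : IntegrableOn
      (fun s => C * (σ s ^ (-(ρ + -e)) / s + σ s ^ (-(ρ + e)) / s)) (Ioi 0) :=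
    ((hint (-e) ⟨by linarith, by linarith⟩).add (hint e ⟨by linarith, by linarith⟩)).const_mul C
  have hgm : Measurable (fun x => r (Real.exp x)) := by
    apply Antitone.measurable
    intro x y hxy
    exact hranti (mem_Ioi.2 (Real.exp_pos _)) (mem_Ioi.2 (Real.exp_pos _)) (Real.exp_le_exp.2 hxy)
  have hmeas : ∀ u, 0 < u → AEStronglyMeasurable (fun s => r (σ s * u) / s / r u)
      (volume.restrict (Ioi 0)) := by
    intro u hu
    have hm : Measurable (fun s => r (Real.exp (Real.log (σ s * u))) / s / r u) :=
      ((hgm.comp (Real.measurable_log.comp (hσmeas.mul_const u))).div measurable_id).div_const _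
    refine hm.aestronglyMeasurable.congr ?_
    filter_upwards [ae_restrict_mem measurableSet_Ioi] with s hs
    rw [Real.exp_log (mul_pos (hσpos s hs) hu)]
  have hbound : ∀ u, X ≤ u → ∀ᵐ s ∂(volume.restrict (Ioi (0:ℝ))), ‖r (σ s * u) / s / r u‖ ≤
      C * (σ s ^ (-(ρ + -e)) / s + σ s ^ (-(ρ + e)) / s) := by
    intro u hu
    filter_upwards [ae_restrict_mem measurableSet_Ioi] with s hs
    have hs : 0 < s := hs
    have hu0 : 0 < u := by linarith
    have h1 := hrpos _ (mul_pos (hσpos s hs) hu0)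
    have h2 := hrpos u hu0
    rw [Real.norm_of_nonneg (by positivity), div_right_comm, ← add_div, ← mul_div_assoc]
    gcongr
    exact hC u hu _ (hσpos s hs)
  constructor
  · filter_upwards [eventually_ge_atTop X] with u hu
    have hu0 : 0 < u := by linarith
    have h3 : IntegrableOn (fun s => r (σ s * u) / s / r u) (Ioi 0) :=
      Integrable.mono' hI (hmeas u hu0) (hbound u hu)
    have h4 := h3.mul_const (r u)
    simp only [div_mul_cancel₀ _ (hrpos u hu0).ne'] at h4
    exact h4
  · simp_rw [← integral_div]
    refine tendsto_integral_filter_of_dominated_convergence _ ?_ ?_ hI ?_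
    · filter_upwards [eventually_gt_atTop 0] with u hu using hmeas u hu
    · filter_upwards [eventually_ge_atTop X] with u hu using hbound u hu
    · filter_upwards [ae_restrict_mem measurableSet_Ioi] with s hs
      simp_rw [div_right_comm _ s]
      exact (hrRV _ (hσpos s hs)).div_const s
end
end
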